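/- arXiv:2601.13720 — 3 statements merged into one kernel-verified Lean document; each statement's English description precedes it below -/
import Mathlib

section
/- Let a, b > 0 be real numbers with a/b irrational, and let c₁, …, c_n > 0 be real numbers. Then there exists a rational number β with 0 < β < 1 such that for every k = 1, …, n, the quotient (a·β + b)/c_k is irrational. -/
/-- If `a / b` is irrational, then `a` and `b` are linearly independent over `ℚ`. -/
theorem Irrational.eq_zero_and_eq_zero_of_div {a b : ℝ} (hab : Irrational (a / b)) {r s : ℚ}
    (h : a * r + b * s = 0) : r = 0 ∧ s = 0 := by
  have hb : b ≠ 0 := by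
    rintro rfl
    simp at hab
  have hr : r = 0 := by
    by_contra hr
    have hr' : (r : ℝ) ≠ 0 := by exact_mod_cast hr
    refine hab ⟨-s / r, ?_⟩
    push_cast
    field_simp
    linarith
  subst hr
  simpa [hb] using h

/-- If `a / b` is irrational and `c ≠ 0`, then at most one rational `β` makes
`(a * β + b) / c` rational. -/
theorem Irrational.subsingleton_not_irrational_mul_add_div {a b c : ℝ}
    (hab : Irrational (a / b)) (hc : c ≠ 0) :
    {β : ℚ | ¬ Irrational ((a * (β : ℝ) + b) / c)}.Subsingleton := by
  intro β hβ γ hγ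
  simp only [Irrational, Set.mem_ofPred_eq, not_not, Set.mem_range] at hβ hγ
  obtain ⟨p, hp⟩ := hβ
  obtain ⟨q, hq⟩ := hγ
  rw [eq_div_iff hc] at hp hq
  have hp0 : p ≠ 0 := by
    rintro rfl
    have := (hab.eq_zero_and_eq_zero_of_div (r := β) (s := 1)
      (by push_cast at hp ⊢; linarith)).2
    exact one_ne_zero this
  obtain ⟨h₁, h₂⟩ := hab.eq_zero_and_eq_zero_of_div (r := q * β - p * γ) (s := q - p)
    (by push_cast; linear_combination (p : ℝ) * hq - (q : ℝ) * hp)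
  obtain rfl : q = p := sub_eq_zero.mp h₂
  exact mul_left_cancel₀ hp0 (sub_eq_zero.mp h₁)

/-- If `a, b > 0` with `a / b` irrational and `c₁, …, cₙ > 0`, then there is a
rational `β` with `0 < β < 1` such that `(a·β + b) / cₖ` is irrational for every `k`. -/
theorem stmt3 (a b : ℝ) (ha : 0 < a) (hb : 0 < b) (hab : Irrational (a / b))
    (n : ℕ) (c : Fin n → ℝ) (hc : ∀ k, 0 < c k) :
    ∃ β : ℚ, 0 < (β : ℝ) ∧ (β : ℝ) < 1 ∧
      ∀ k : Fin n, Irrational ((a * (β : ℝ) + b) / c k) := by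
  have hfin : (⋃ k, {β : ℚ | ¬ Irrational ((a * (β : ℝ) + b) / c k)}).Finite :=
    Set.finite_iUnion fun k =>
      (hab.subsingleton_not_irrational_mul_add_div (hc k).ne').finite
  obtain ⟨β, ⟨h0, h1⟩, hβ⟩ :=
    ((Set.Ioo_infinite (zero_lt_one (α := ℚ))).sdiff hfin).nonempty
  simp only [Set.mem_iUnion, Set.mem_ofPred_eq, not_exists, not_not] at hβ
  exact ⟨β, by exact_mod_cast h0, by exact_mod_cast h1, hβ⟩
end

section
/- Let α be an irrational real number, θ a real number, and A ⊆ ℕ a set with upper density d*(A) = γ > 0. Then there exists n ∈ A such that the fractional part {α·n + θ} satisfies γ/4 ≤ {α·n + θ} ≤ 1 − γ/4. -/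
open Filter

/-- The upper density of a set `A ⊆ ℕ`:
`d*(A) = limsup_{N → ∞} |A ∩ {1, …, N}| / N`. -/
noncomputable def upperDensity (A : Set ℕ) : ℝ :=
  limsup (fun N : ℕ => (Nat.card ↥(A ∩ Set.Icc 1 N) : ℝ) / (N : ℝ)) atTop

/-- An irrational number has reduced rational approximations of arbitrarily large denominator `q`
with error at most `1 / q ^ 2`. -/
theorem Irrational.exists_rat_lt_den_abs_sub_le {α : ℝ} (hα : Irrational α) (M : ℕ) :
    ∃ r : ℚ, M < r.den ∧ |α - r| ≤ 1 / (r.den : ℝ) ^ 2 := by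
  obtain ⟨ε, hε, hεpos⟩ := ((hα.eventually_forall_le_dist_cast_rat_of_den_le M).filter_mono
    nhdsWithin_le_nhds |>.and (self_mem_nhdsWithin (s := Set.Ioi (0 : ℝ)))).exists
  obtain ⟨n, hn⟩ := exists_nat_one_div_lt hεpos
  obtain ⟨r, hr, hrn⟩ := Real.exists_rat_abs_sub_le_and_den_le α n.succ_pos
  have hd : (1 : ℝ) ≤ r.den := by exact_mod_cast r.den_pos
  have hrn' : (r.den : ℝ) ≤ n + 1 := by exact_mod_cast hrn
  have hn0 : (0 : ℝ) < n + 1 := by positivity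
  push_cast at hr
  refine ⟨r, ?_, hr.trans ?_⟩
  · by_contra! hM
    have h := hε r hM
    rw [Real.dist_eq] at h
    have : 1 / (((n : ℝ) + 1 + 1) * r.den) ≤ 1 / ((n : ℝ) + 1) := by
      gcongr
      nlinarith
    linarith
  · gcongr
    nlinarith

/-- If the fractional part of `x` lies within `δ` of `0` or `1`, then `x` lies within `δ` of
an integer. -/
theorem exists_int_abs_sub_lt_of_fract {x δ : ℝ}
    (h : δ ≤ Int.fract x → 1 - δ < Int.fract x) : ∃ m : ℤ, |x - m| < δ := by
  have h0 := Int.fract_nonneg x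
  have h1 := Int.fract_lt_one x
  have h2 := Int.floor_add_fract x
  by_cases hx : δ ≤ Int.fract x
  · refine ⟨⌊x⌋ + 1, ?_⟩
    have := h hx
    push_cast
    rw [abs_lt]
    constructor <;> linarith
  · refine ⟨⌊x⌋, ?_⟩
    rw [abs_lt]
    constructor <;> linarith

/-- An interval of radius `w ≥ 0` contains at most `2 * w + 1` integers. -/
theorem Int.card_Icc_ceil_floor_le (c : ℝ) {w : ℝ} (hw : 0 ≤ w) :
    ((Finset.Icc ⌈c - w⌉ ⌊c + w⌋).card : ℝ) ≤ 2 * w + 1 := by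
  rw [Int.card_Icc]
  have h1 := Int.le_ceil (c - w)
  have h2 := Int.floor_le (c + w)
  rcases le_total 0 (⌊c + w⌋ + 1 - ⌈c - w⌉) with h | h
  · have : (((⌊c + w⌋ + 1 - ⌈c - w⌉).toNat : ℤ) : ℝ) = ((⌊c + w⌋ + 1 - ⌈c - w⌉ : ℤ) : ℝ) := by
      rw [Int.toNat_of_nonneg h]
    push_cast at this
    linarith
  · rw [Int.toNat_of_nonpos h]
    push_cast
    linarith

open Classical in
/-- If `r` approximates `α` to within `1 / r.den ^ 2`, then among the first `r.den` terms of the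
progression `β + α * i`, at most `2 * r.den * δ + 3` are within `δ` of an integer. -/
theorem card_near_int_le {α : ℝ} {r : ℚ} (hr : |α - r| ≤ 1 / (r.den : ℝ) ^ 2)
    (β : ℝ) {δ : ℝ} (hδ : 0 ≤ δ) :
    (((Finset.range r.den).filter fun i : ℕ => ∃ m : ℤ, |α * i + β - m| < δ).card : ℝ) ≤
      2 * (r.den * δ) + 3 := by
  have hq : (0 : ℝ) < r.den := by exact_mod_cast r.den_pos
  have hw : 0 ≤ r.den * δ + 1 := by positivity
  refine le_trans ?_ ((Int.card_Icc_ceil_floor_le (-(r.den * β)) hw).trans (by linarith))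
  have hm : ∀ i : ℕ, ∃ m : ℤ, (∃ m : ℤ, |α * i + β - m| < δ) → |α * i + β - m| < δ := fun i => by
    by_cases h : ∃ m : ℤ, |α * i + β - m| < δ
    · exact ⟨h.choose, fun _ => h.choose_spec⟩
    · exact ⟨0, fun h' => absurd h' h⟩
  choose m hm using hm
  rw [Nat.cast_le]
  refine Finset.card_le_card_of_injOn (fun i => r.num * i - m i * r.den) ?_ ?_
  · intro i hi
    simp only [Finset.coe_filter, Finset.mem_range, Set.mem_ofPred_eq] at hi
    have h1 := abs_lt.1 (hm i hi.2)
    have hiq : (i : ℝ) ≤ r.den := by exact_mod_cast hi.1.le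
    have h2 : |r.den * (i * (α - r))| ≤ 1 := by
      rw [abs_mul, abs_mul, Nat.abs_cast, Nat.abs_cast]
      calc (r.den : ℝ) * (i * |α - r|) ≤ r.den * (r.den * (1 / (r.den : ℝ) ^ 2)) := by gcongr
        _ = 1 := by field_simp
    have h3 : (r : ℝ) * r.den = r.num := by exact_mod_cast Rat.mul_den_eq_num r
    have h4 : (r.num * i - m i * r.den : ℝ) =
        r.den * (α * i + β - m i) - r.den * (i * (α - r)) - r.den * β := by
      rw [← h3]; ring
    have h2' := abs_le.1 h2
    have h5 := mul_lt_mul_of_pos_left h1.1 hq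
    have h6 := mul_lt_mul_of_pos_left h1.2 hq
    simp only [Finset.coe_Icc, Set.mem_Icc, Int.ceil_le, Int.le_floor]
    push_cast
    rw [h4]
    constructor <;> linarith
  · intro i hi j hj hij
    simp only [Finset.coe_filter, Finset.mem_range, Set.mem_ofPred_eq] at hi hj hij
    have hdvd : (r.den : ℤ) ∣ r.num * ((i : ℤ) - j) := ⟨m i - m j, by linear_combination hij⟩
    have hcop : IsCoprime (r.den : ℤ) r.num := by
      rw [Int.isCoprime_iff_nat_coprime]
      exact r.reduced.symm
    have h := hcop.dvd_of_dvd_mul_left hdvd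
    have h' := Int.eq_zero_of_abs_lt_dvd h (by rw [abs_lt]; omega)
    omega

open Classical in
/-- A set meeting each block of `q` consecutive naturals in at most `C` points has at most
`k * C` points below `k * q`. -/
theorem card_filter_range_mul_le {p : ℕ → Prop} {q : ℕ} {C : ℝ}
    (h : ∀ s, (((Finset.range q).filter fun i => p (s + i)).card : ℝ) ≤ C) (k : ℕ) :
    (((Finset.range (k * q)).filter p).card : ℝ) ≤ k * C := by
  simp only [← Nat.count_eq_card_filter_range] at h ⊢
  induction k with
  | zero => simp
  | succ k ih =>
    rw [add_mul, one_mul, Nat.count_add]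
    push_cast
    linarith [h (k * q)]

/-- If `A` has at most `k * C` positive elements below `k * q`, for every `k`, then the upper
density of `A` is at most every `L > C / q`. -/
theorem upperDensity_le_of_block {A : Set ℕ} {q : ℕ} (hq : 0 < q) {C L : ℝ} (hL : C / q < L)
    (hA : ∀ N k : ℕ, N < k * q → (Nat.card ↥(A ∩ Set.Icc 1 N) : ℝ) ≤ k * C) :
    upperDensity A ≤ L := by
  have hq' : (0 : ℝ) < q := by exact_mod_cast hq
  have hC : 0 ≤ C := by simpa using (Nat.cast_nonneg _).trans (hA 0 1 (by simpa))
  refine limsup_le_of_le (isCoboundedUnder_le_of_le atTop (x := 0) fun N => by positivity) ?_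
  have hlim : Tendsto (fun N : ℕ => C / q + C / (N : ℝ)) atTop (nhds (C / q + 0)) :=
    tendsto_const_nhds.add (tendsto_const_div_atTop_nhds_zero_nat C)
  rw [add_zero] at hlim
  filter_upwards [hlim.eventually_lt_const hL, eventually_gt_atTop 0] with N hN hN0
  have hN0' : (0 : ℝ) < N := by exact_mod_cast hN0
  refine le_trans ?_ hN.le
  have h := hA N (N / q + 1) (by rw [mul_comm]; exact Nat.lt_mul_div_succ N hq)
  have hdiv : ((N / q : ℕ) : ℝ) ≤ N / q := Nat.cast_div_le
  rw [div_le_iff₀ hN0']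
  push_cast at h
  calc _ ≤ _ := h
    _ ≤ ((N : ℝ) / q + 1) * C := by gcongr
    _ = _ := by field_simp

/-- If `α` is irrational, `θ ∈ ℝ`, and `A ⊆ ℕ` has upper density `γ > 0`,
then there is `n ∈ A` with `γ/4 ≤ {α·n + θ} ≤ 1 − γ/4`, where `{·}` is the fractional part. -/
theorem stmt6 (α θ : ℝ) (hα : Irrational α) (A : Set ℕ) (γ : ℝ)
    (hγpos : 0 < γ) (hdens : upperDensity A = γ) :
    ∃ n ∈ A, γ / 4 ≤ Int.fract (α * (n : ℝ) + θ) ∧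
      Int.fract (α * (n : ℝ) + θ) ≤ 1 - γ / 4 := by
  by_contra! hcon
  obtain ⟨M, hM⟩ := exists_nat_gt (12 / γ)
  obtain ⟨r, hMr, hr⟩ := hα.exists_rat_lt_den_abs_sub_le M
  have hq : (0 : ℝ) < r.den := by exact_mod_cast r.den_pos
  have hlarge : 12 < r.den * γ := by
    rw [← div_lt_iff₀ hγpos]
    exact hM.trans (by exact_mod_cast hMr)
  have hle : upperDensity A ≤ 7 * γ / 8 := by
    refine upperDensity_le_of_block r.den_pos (C := 2 * (r.den * (γ / 4)) + 3) ?_ fun N k hN => ?_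
    · rw [div_lt_iff₀ hq]
      linarith
    · classical
      refine le_trans ?_ (card_filter_range_mul_le (q := r.den)
        (p := fun n : ℕ => ∃ m : ℤ, |α * n + θ - m| < γ / 4) (fun s => ?_) k)
      · rw [Nat.cast_le, Nat.card_coe_set_eq, ← Set.ncard_coe_finset]
        refine Set.ncard_le_ncard (fun n hn => ?_) (Finset.finite_toSet _)
        simp only [Finset.coe_filter, Finset.mem_range, Set.mem_ofPred_eq]
        exact ⟨hn.2.2.trans_lt hN, exists_int_abs_sub_lt_of_fract (hcon n hn.1)⟩
      · convert card_near_int_le hr (α * s + θ) (by positivity : 0 ≤ γ / 4) using 7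
        push_cast
        ring_nf
  linarith
end

section
/- Let a, b, c > 0 be real numbers with a/b irrational, let β be a rational number with 0 < β < 1 such that (a·β + b)/c is irrational, let G : ℕ × ℕ → ℕ be any function, and let T ⊆ ℕ be a set with upper density d*(T) = γ > 0. Define S = {c·G(n, ⌊β·n⌋) − (a·⌊β·n⌋ + b·n) : n ∈ T}. Then for every A ∈ ℝ and every δ with 0 < δ < γ·c/4, the set S is not contained in the interval [A − δ, A + δ]; i.e., there exists n ∈ T with |c·G(n, ⌊β·n⌋) − (a·⌊β·n⌋ + b·n) − A| > δ. -/
open Filter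

/-- If no two elements of `T` differ by `d * M` with `0 < d < k`, then the `k` translates of `T` by
multiples of `M` are disjoint, so `T` has upper density at most `1 / k`. -/
theorem upperDensity_le_one_div_of_disjoint_translates (T : Set ℕ) (k M : ℕ) (hk : 0 < k)
    (hT : ∀ n ∈ T, ∀ d : ℕ, 0 < d → d < k → n + d * M ∉ T) :
    upperDensity T ≤ 1 / (k : ℝ) := by
  have hcard : ∀ N : ℕ, k * Nat.card ↥(T ∩ Set.Icc 1 N) ≤ N + k * M := by
    intro N
    have : Finite ↥(T ∩ Set.Icc 1 N) := ((Set.finite_Icc 1 N).inter_of_right T).to_subtype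
    let f : Fin k × ↥(T ∩ Set.Icc 1 N) → ↥(Set.Icc 1 (N + k * M)) := fun x =>
      ⟨x.2.1 + x.1.1 * M, by
        have h1 := x.2.2.2.1
        have h2 := x.2.2.2.2
        have h3 : x.1.1 * M ≤ k * M := Nat.mul_le_mul_right M x.1.2.le
        exact ⟨by omega, by omega⟩⟩
    have hlt : ∀ x y : Fin k × ↥(T ∩ Set.Icc 1 N), f x = f y → ¬ x.1.1 < y.1.1 := by
      intro x y hxy hlt
      have h1 : x.2.1 + x.1.1 * M = y.2.1 + y.1.1 * M := congrArg Subtype.val hxy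
      obtain ⟨d, hd⟩ := Nat.exists_eq_add_of_lt hlt
      have h2 : x.2.1 = y.2.1 + (d + 1) * M := by
        rw [hd] at h1
        linarith
      have h3 := y.1.2
      exact hT y.2.1 y.2.2.1 (d + 1) (by omega) (by omega) (h2 ▸ x.2.2.1)
    have hf : Function.Injective f := by
      intro x y hxy
      have h0 : x.1.1 = y.1.1 :=
        le_antisymm (not_lt.1 (hlt y x hxy.symm)) (not_lt.1 (hlt x y hxy))
      have h1 : x.2.1 + x.1.1 * M = y.2.1 + y.1.1 * M := congrArg Subtype.val hxy
      rw [h0] at h1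
      exact Prod.ext (Fin.ext h0) (Subtype.ext (Nat.add_right_cancel h1))
    have := Nat.card_le_card_of_injective f hf
    simpa [Nat.card_prod] using this
  have hk' : (0 : ℝ) < k := by exact_mod_cast hk
  have hlim : Tendsto (fun N : ℕ => 1 / (k : ℝ) + (M : ℝ) / (N : ℝ)) atTop (nhds (1 / (k : ℝ))) := by
    simpa using (tendsto_const_div_atTop_nhds_zero_nat (M : ℝ)).const_add (1 / (k : ℝ))
  rw [upperDensity, ← hlim.limsup_eq]
  refine limsup_le_limsup ?_ ?_ hlim.isBoundedUnder_le
  · filter_upwards [eventually_gt_atTop 0] with N hN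
    have hN' : (0 : ℝ) < N := by exact_mod_cast hN
    have h : (k : ℝ) * Nat.card ↥(T ∩ Set.Icc 1 N) ≤ N + k * M := by exact_mod_cast hcard N
    rw [div_add_div _ _ hk'.ne' hN'.ne', div_le_div_iff₀ hN' (by positivity)]
    nlinarith
  · exact IsBoundedUnder.isCoboundedUnder_le ⟨0, eventually_map.2 (Eventually.of_forall fun N => by
      positivity)⟩

/-- For irrational `θ` and `k * L < 1`, some natural multiple `x` of `θ` is such that
`x, 2 * x, …, (k - 1) * x` all have distance greater than `L` to the integers. -/
theorem Irrational.exists_nat_mul_separated {θ : ℝ} (hθ : Irrational θ) {k : ℕ} (hk : 0 < k)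
    {L : ℝ} (hL : k * L < 1) :
    ∃ h : ℕ, ∀ d : ℕ, 0 < d → d < k → ∀ z : ℤ, L < |(d : ℝ) * (h * θ) - z| := by
  have hk' : (0 : ℝ) < k := by exact_mod_cast hk
  have hη : 0 < (1 / (k : ℝ) - L) / k := by
    have : L < 1 / (k : ℝ) := by
      rw [lt_div_iff₀ hk']
      linarith
    exact div_pos (by linarith) hk'
  obtain ⟨x, hx, hdist⟩ :=
    (dense_addSubgroupClosure_pair_iff.2 (one_div θ ▸ hθ.inv)).exists_dist_lt (1 / (k : ℝ)) hη
  obtain ⟨y, g, rfl⟩ := AddSubgroup.mem_closure_pair.1 hx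
  rw [Real.dist_eq] at hdist
  have key : ∀ d : ℕ, 0 < d → d < k → ∀ z : ℤ, L < |(d : ℝ) * (g * θ) - z| := by
    intro d hd hdk z
    have hd' : (0 : ℝ) < d := by exact_mod_cast hd
    have hdk' : (d : ℝ) < k := by exact_mod_cast hdk
    have hne : (d : ℤ) - k * (z + d * y) ≠ 0 := by
      intro h0
      have hdvd : (k : ℤ) ∣ d := ⟨_, sub_eq_zero.1 h0⟩
      exact absurd (Nat.le_of_dvd hd (Int.natCast_dvd_natCast.1 hdvd)) (by omega)
    have h1 : (1 : ℝ) ≤ |(d : ℝ) - k * (z + d * y)| := by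
      exact_mod_cast Int.one_le_abs hne
    have h2 : 1 / (k : ℝ) ≤ |(d : ℝ) / k - (z + d * y)| := by
      have : (d : ℝ) / k - (z + d * y) = ((d : ℝ) - k * (z + d * y)) / k := by
        field_simp
      rw [this, abs_div, abs_of_pos hk']
      gcongr
    have h3 : |(d : ℝ) * (1 / (k : ℝ) - (y • (1 : ℝ) + g • θ))| < 1 / (k : ℝ) - L := by
      rw [abs_mul, abs_of_pos hd']
      calc (d : ℝ) * _ < d * ((1 / (k : ℝ) - L) / k) := by gcongr
        _ ≤ k * ((1 / (k : ℝ) - L) / k) := by gcongr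
        _ = _ := by field_simp
    have h4 : (d : ℝ) / k - (z + d * y) =
        d * (1 / (k : ℝ) - (y • (1 : ℝ) + g • θ)) + (d * (g * θ) - z) := by
      simp only [zsmul_eq_mul]
      ring
    rw [h4] at h2
    have h5 := abs_add_le (d * (1 / (k : ℝ) - (y • (1 : ℝ) + g • θ))) (d * (g * θ) - z)
    linarith
  refine ⟨g.natAbs, fun d hd hdk z => ?_⟩
  rcases Int.natAbs_eq g with hg | hg
  · have hg' : ((g.natAbs : ℕ) : ℝ) = g := by
      conv_rhs => rw [hg]
      simp
    rw [hg']
    exact key d hd hdk z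
  · have hg' : ((g.natAbs : ℕ) : ℝ) = -g := by
      conv_rhs => rw [hg]
      simp
    rw [hg', ← abs_neg]
    convert key d hd hdk (-z) using 2
    push_cast
    ring

/-- Let `a, b, c > 0` with `a/b` irrational, `β ∈ ℚ ∩ (0,1)` with
`(a·β + b)/c` irrational, `G : ℕ × ℕ → ℕ` arbitrary, and `T ⊆ ℕ` of upper density `γ > 0`.
Then for every `A ∈ ℝ` and `0 < δ < γ·c/4` the set
`S = {c·G(n,⌊β·n⌋) − (a·⌊β·n⌋ + b·n) : n ∈ T}` is not contained in `[A − δ, A + δ]`: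
there exists `n ∈ T` with `|c·G(n,⌊β·n⌋) − (a·⌊β·n⌋ + b·n) − A| > δ`. -/
theorem stmt7 (a b c : ℝ) (ha : 0 < a) (hb : 0 < b) (hc : 0 < c)
    (hab : Irrational (a / b)) (β : ℚ) (hβ0 : 0 < (β : ℝ)) (hβ1 : (β : ℝ) < 1)
    (hβirr : Irrational ((a * (β : ℝ) + b) / c))
    (G : ℕ × ℕ → ℕ) (T : Set ℕ) (γ : ℝ) (hγpos : 0 < γ)
    (hdens : upperDensity T = γ)
    (A : ℝ) (δ : ℝ) (hδ0 : 0 < δ) (hδ : δ < γ * c / 4) :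
    ∃ n ∈ T,
      |c * (G (n, ⌊(β : ℝ) * (n : ℝ)⌋₊) : ℝ) -
        (a * (⌊(β : ℝ) * (n : ℝ)⌋₊ : ℝ) + b * (n : ℝ)) - A| > δ := by
  by_contra! hcon
  have hγ1 : γ ≤ 1 := by
    simpa [hdens] using upperDensity_le_one_div_of_disjoint_translates T 1 0 one_pos
      (fun n _ d h1 h2 => by omega)
  obtain ⟨k, hk, hkγ, hkγ'⟩ : ∃ k : ℕ, 0 < k ∧ 1 < k * γ ∧ k * γ ≤ 2 := by
    refine ⟨⌊1 / γ⌋₊ + 1, Nat.succ_pos _, ?_, ?_⟩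
    · have := Nat.lt_floor_add_one (1 / γ)
      rw [div_lt_iff₀ hγpos] at this
      push_cast
      exact this
    · have := Nat.floor_le (by positivity : 0 ≤ 1 / γ)
      rw [le_div_iff₀ hγpos] at this
      push_cast
      linarith
  have hk' : (0 : ℝ) < k := by exact_mod_cast hk
  obtain ⟨p, hp⟩ : ∃ p : ℕ, (β : ℝ) * β.den = p := by
    refine ⟨β.num.toNat, ?_⟩
    have h0 : 0 ≤ β.num := Rat.num_nonneg.2 (by exact_mod_cast hβ0.le)
    have h1 : ((β.num.toNat : ℕ) : ℤ) = β.num := Int.toNat_of_nonneg h0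
    have h2 : β * β.den = ((β.num.toNat : ℤ) : ℚ) := by rw [h1, Rat.mul_den_eq_num]
    exact_mod_cast h2
  have hθ : Irrational ((a * β + b) / c * (β.den : ℝ)) := hβirr.mul_natCast β.den_ne_zero
  have hL : k * (2 * δ / c) < 1 := by
    rw [← mul_div_assoc, div_lt_one hc]
    nlinarith [mul_lt_mul_of_pos_left hδ hk', mul_le_mul_of_nonneg_right hkγ' hc.le]
  obtain ⟨h, hh⟩ := hθ.exists_nat_mul_separated hk hL
  have hle := upperDensity_le_one_div_of_disjoint_translates T k (β.den * h) hk (by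
    intro n hn d hd hdk hmem
    have h1 := hcon n hn
    have h2 := hcon _ hmem
    have hfloor : ⌊(β : ℝ) * ((n + d * (β.den * h) : ℕ) : ℝ)⌋₊ =
        ⌊(β : ℝ) * (n : ℝ)⌋₊ + d * h * p := by
      rw [← Nat.floor_add_natCast (by positivity)]
      congr 1
      push_cast
      rw [← hp]
      ring
    rw [hfloor] at h2
    generalize G (n + d * (β.den * h), _) = u at h2
    generalize G (n, _) = v at h1
    have h3 := hh d hd hdk ((u : ℤ) - v)
    rw [div_lt_iff₀ hc, ← abs_of_pos hc, ← abs_mul, abs_of_pos hc] at h3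
    have h4 : (d * (h * ((a * β + b) / c * (β.den : ℝ))) - (((u : ℤ) - v : ℤ) : ℝ)) * c =
        (c * v - (a * (⌊(β : ℝ) * (n : ℝ)⌋₊ : ℝ) + b * n) - A) -
        (c * u - (a * ((⌊(β : ℝ) * (n : ℝ)⌋₊ + d * h * p : ℕ) : ℝ) +
          b * ((n + d * (β.den * h) : ℕ) : ℝ)) - A) := by
      push_cast
      rw [← hp]
      field_simp
      ring
    rw [h4] at h3
    linarith [abs_sub (c * v - (a * (⌊(β : ℝ) * (n : ℝ)⌋₊ : ℝ) + b * n) - A)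
      (c * u - (a * ((⌊(β : ℝ) * (n : ℝ)⌋₊ + d * h * p : ℕ) : ℝ) +
          b * ((n + d * (β.den * h) : ℕ) : ℝ)) - A)])
  rw [hdens, le_div_iff₀ hk'] at hle
  linarith
end
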